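/- arXiv:2301.08224 — 5 statements merged into one kernel-verified Lean document; each statement's English description precedes it below -/
import Mathlib

section
/- Let μ ∈ ℝ and z₀ > max(0, −4μ). Then for every continuously differentiable function u : ℝ → ℝ with compact support contained in (z₀,∞), one has ∫_{z₀}^∞ (u'(z)² + (μ/z)·u(z)²)·e^z dz ≥ 0, with strict inequality whenever u is not identically zero. -/
open MeasureTheory Set

/-- positivity of the quadratic form of `−𝓛_μ` with weight `e^z` on
compactly supported `C¹` functions in `(z₀,∞)`, when `z₀ > max(0, −4μ)`;
the inequality is strict whenever `u` is not identically zero. -/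
theorem quadratic_form_positive (μ z₀ : ℝ) (hz₀ : z₀ > max 0 (-4 * μ))
    (u : ℝ → ℝ) (hu : ContDiff ℝ 1 u) (hsupp : HasCompactSupport u)
    (hsub : tsupport u ⊆ Ioi z₀) :
    (0 ≤ ∫ z in Ioi z₀, (deriv u z ^ 2 + (μ / z) * u z ^ 2) * Real.exp z) ∧
    (u ≠ 0 →
      0 < ∫ z in Ioi z₀, (deriv u z ^ 2 + (μ / z) * u z ^ 2) * Real.exp z) := by
  obtain ⟨h0, h1⟩ := max_lt_iff.mp hz₀
  have hu0 : ∀ z, z ≤ z₀ → u z = 0 := fun z hz =>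
    image_eq_zero_of_notMem_tsupport (fun h => absurd (hsub h) (not_lt.mpr hz))
  have hdu0 : ∀ z, z ≤ z₀ → deriv u z = 0 := fun z hz =>
    image_eq_zero_of_notMem_tsupport
      (fun h => absurd (hsub (tsupport_deriv_subset (𝕜 := ℝ) h)) (not_lt.mpr hz))
  have hmaxpos : ∀ z, 0 < max z z₀ := fun z => lt_max_of_lt_right h0
  have hcu : Continuous u := hu.continuous
  have hcd : Continuous (deriv u) := hu.continuous_deriv le_rfl
  have hsd : HasCompactSupport (deriv u) := hsupp.deriv
  have hcm : Continuous (fun z : ℝ => μ / max z z₀) :=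
    continuous_const.div (continuous_id.max continuous_const) (fun z => (hmaxpos z).ne')
  have hcoef : ∀ z, 0 < 1 / 4 + μ / max z z₀ := by
    intro z
    have hp := hmaxpos z
    have : z₀ ≤ max z z₀ := le_max_right _ _
    have : 1 / 4 + μ / max z z₀ = (max z z₀ + 4 * μ) / (4 * max z z₀) := by
      field_simp
    rw [this]
    apply div_pos <;> linarith
  set P : ℝ → ℝ := fun z =>
    ((deriv u z + u z / 2) ^ 2 + (1 / 4 + μ / max z z₀) * u z ^ 2) * Real.exp z with hP
  set w : ℝ → ℝ := fun z => u z ^ 2 * Real.exp z with hw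
  have hwC : ContDiff ℝ 1 w := (hu.pow 2).mul Real.contDiff_exp
  have hws : HasCompactSupport w :=
    hsupp.mono (fun z hz h => hz (by simp [hw, h]))
  have hwd : ∀ z, deriv w z = (2 * u z * deriv u z + u z ^ 2) * Real.exp z := by
    intro z
    have hd : HasDerivAt u (deriv u z) z := (hu.differentiable one_ne_zero z).hasDerivAt
    have := ((hd.pow 2).mul (Real.hasDerivAt_exp z)).deriv
    refine Eq.trans this ?_
    simp
    ring
  have hPc : Continuous P := by
    have := Real.continuous_exp
    fun_prop
  have hPs : HasCompactSupport P := by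
    refine HasCompactSupport.of_support_subset_isCompact (hsupp.isCompact) ?_
    intro z hz
    by_contra h
    apply hz
    have e1 := image_eq_zero_of_notMem_tsupport h
    have e2 : deriv u z = 0 := image_eq_zero_of_notMem_tsupport
      (fun h' => h (tsupport_deriv_subset (𝕜 := ℝ) h'))
    simp [hP, e1, e2]
  have hPn : 0 ≤ P := fun z => by
    have := hcoef z
    simp only [hP, Pi.zero_apply]
    positivity
  have hwi : Integrable (deriv w) :=
    (hwC.continuous_deriv le_rfl).integrable_of_hasCompactSupport hws.deriv
  have hPi : Integrable P := hPc.integrable_of_hasCompactSupport hPs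
  have hint : ∫ z in Ioi z₀, (deriv u z ^ 2 + (μ / z) * u z ^ 2) * Real.exp z = ∫ z, P z := by
    have e : ∫ z in Ioi z₀, (deriv u z ^ 2 + (μ / z) * u z ^ 2) * Real.exp z
        = ∫ z in Ioi z₀, (P z - 1 / 2 * deriv w z) := by
      refine setIntegral_congr_fun measurableSet_Ioi (fun z hz => ?_)
      have hm : max z z₀ = z := max_eq_left (le_of_lt hz)
      simp only [hP, hwd, hm]
      ring
    rw [e, integral_sub hPi.integrableOn (hwi.const_mul _).integrableOn,
      integral_const_mul, hws.integral_Ioi_deriv_eq hwC]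
    have : w z₀ = 0 := by simp [hw, hu0 z₀ le_rfl]
    rw [this, setIntegral_eq_integral_of_forall_compl_eq_zero]
    · simp
    · intro z hz
      have hz' : z ≤ z₀ := not_lt.mp hz
      simp [hP, hu0 z hz', hdu0 z hz']
  rw [hint]
  refine ⟨integral_nonneg hPn, fun hne => ?_⟩
  obtain ⟨x, hx⟩ := Function.ne_iff.mp hne
  have hx' : u x ≠ 0 := hx
  refine hPc.integral_pos_of_hasCompactSupport_nonneg_nonzero hPs hPn (x := x) ?_
  have := hcoef x
  simp only [hP]
  positivity
end

section
/- For every Λ > 1 there exists a constant C(Λ) > 4 such that for every μ ∈ ℝ with |μ| < Λ and every z ≥ C(Λ), both functions f₊(z) = z^{μ−1/2} + z^{μ} and f₋(z) = z^{μ−1/2} − z^{μ} satisfy (𝓛_μ f_±)(z) = z^{μ−2}·( −√z/2 ± μ(μ−1) + (2μ−1)(2μ−3)/(4√z) ) ≤ 0. -/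
open Set

lemma barrier_eq (c μ z : ℝ) (hz : 0 < z) :
    deriv (deriv (fun w : ℝ => w ^ (μ - 1/2) + c * w ^ μ)) z
      + deriv (fun w : ℝ => w ^ (μ - 1/2) + c * w ^ μ) z
      - (μ / z) * (z ^ (μ - 1/2) + c * z ^ μ)
    = z ^ (μ - 2) * (-Real.sqrt z / 2 + c * (μ * (μ - 1))
        + (2 * μ - 1) * (2 * μ - 3) / (4 * Real.sqrt z)) := by
  have h1 : ∀ (a b p q x : ℝ), 0 < x →
      HasDerivAt (fun w : ℝ => p * w ^ a + q * w ^ b)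
        (p * (a * x ^ (a - 1)) + q * (b * x ^ (b - 1))) x := by
    intro a b p q x hx
    exact ((Real.hasDerivAt_rpow_const (Or.inl hx.ne')).const_mul p).add
      ((Real.hasDerivAt_rpow_const (Or.inl hx.ne')).const_mul q)
  have hd : ∀ x : ℝ, 0 < x → deriv (fun w : ℝ => w ^ (μ - 1/2) + c * w ^ μ) x
      = (μ - 1/2) * x ^ (μ - 1/2 - 1) + (c * μ) * x ^ (μ - 1) := by
    intro x hx
    have := (h1 (μ - 1/2) μ 1 c x hx).deriv
    simp only [one_mul] at this
    rw [this]; ring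
  have he : deriv (fun w : ℝ => w ^ (μ - 1/2) + c * w ^ μ) =ᶠ[nhds z]
      (fun x : ℝ => (μ - 1/2) * x ^ (μ - 1/2 - 1) + (c * μ) * x ^ (μ - 1)) := by
    filter_upwards [lt_mem_nhds hz] with x hx using hd x hx
  rw [he.deriv_eq, (h1 _ _ _ _ z hz).deriv, hd z hz]
  have hs : 0 < Real.sqrt z := Real.sqrt_pos.2 hz
  have hss : Real.sqrt z ^ 2 = z := Real.sq_sqrt hz.le
  have hhalf : z ^ (1/2 : ℝ) = Real.sqrt z := (Real.sqrt_eq_rpow z).symm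
  have e0 : z ^ μ = z ^ (μ - 2) * z ^ 2 := by
    rw [← Real.rpow_natCast, ← Real.rpow_add hz]; norm_num
  have e1 : z ^ (μ - 1) = z ^ (μ - 2) * z := by
    rw [← Real.rpow_add_one hz.ne']; congr 1; ring
  have e2 : z ^ (μ - 1 - 1) = z ^ (μ - 2) := by congr 1; ring
  have f2 : z ^ (μ - 1/2 - 1 - 1) = z ^ (μ - 2) / Real.sqrt z := by
    rw [← hhalf, ← Real.rpow_sub hz]; congr 1; ring
  have f1 : z ^ (μ - 1/2 - 1) = z ^ (μ - 2) / Real.sqrt z * z := by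
    rw [← f2, ← Real.rpow_add_one hz.ne']; congr 1; ring
  have f0 : z ^ (μ - 1/2) = z ^ (μ - 2) / Real.sqrt z * z * z := by
    rw [← f1, ← Real.rpow_add_one hz.ne']; congr 1; ring
  rw [f2, f1, f0, e2, e1, e0]
  generalize z ^ (μ - 2) = A
  generalize Real.sqrt z = s at hs hss
  subst hss
  field_simp
  ring

lemma barrier_nonpos (Λ c μ z : ℝ) (hΛ : 1 < Λ) (hc : |c| ≤ 1) (hμ : |μ| < Λ)
    (hz : (8 * Λ ^ 2) ^ 2 ≤ z) :
    z ^ (μ - 2) * (-Real.sqrt z / 2 + c * (μ * (μ - 1))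
        + (2 * μ - 1) * (2 * μ - 3) / (4 * Real.sqrt z)) ≤ 0 := by
  have hs : 8 * Λ ^ 2 ≤ Real.sqrt z := Real.le_sqrt_of_sq_le hz
  have hz0 : 0 ≤ z := le_trans (by positivity) hz
  apply mul_nonpos_of_nonneg_of_nonpos (Real.rpow_nonneg hz0 _)
  have hs0 : 0 < Real.sqrt z := by nlinarith
  have hm2 : μ ^ 2 ≤ Λ ^ 2 := by rw [← sq_abs]; gcongr
  have hml := abs_lt.1 hμ
  have hL : Λ ≤ Λ ^ 2 := by nlinarith
  have a1 : c * (μ * (μ - 1)) ≤ 2 * Λ ^ 2 := by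
    refine (le_abs_self _).trans ?_
    rw [abs_mul]
    have : |μ * (μ - 1)| ≤ 2 * Λ ^ 2 := by
      rw [abs_le]; constructor <;> nlinarith
    nlinarith [abs_nonneg (μ * (μ - 1))]
  have a2 : (2 * μ - 1) * (2 * μ - 3) / (4 * Real.sqrt z) ≤ 1 := by
    rw [div_le_one (by positivity)]; nlinarith
  nlinarith

/-- for every `Λ > 1` there is `C(Λ) > 4` such that for `|μ| < Λ` and
`z ≥ C(Λ)`, the barriers `f₊(z) = z^{μ−1/2} + z^μ` and `f₋(z) = z^{μ−1/2} − z^μ`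
satisfy `𝓛_μ f_± (z) = z^{μ−2}(−√z/2 ± μ(μ−1) + (2μ−1)(2μ−3)/(4√z)) ≤ 0`,
where `𝓛_μ u = u'' + u' − (μ/z)u`. -/
theorem barrier_supersolutions (Λ : ℝ) (hΛ : Λ > 1) :
    ∃ C : ℝ, C > 4 ∧
      ∀ μ : ℝ, |μ| < Λ → ∀ z : ℝ, z ≥ C →
        ((deriv (deriv (fun w : ℝ => w ^ (μ - 1/2) + w ^ μ)) z
            + deriv (fun w : ℝ => w ^ (μ - 1/2) + w ^ μ) z
            - (μ / z) * (z ^ (μ - 1/2) + z ^ μ)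
          = z ^ (μ - 2) *
              (-Real.sqrt z / 2 + μ * (μ - 1)
                + (2 * μ - 1) * (2 * μ - 3) / (4 * Real.sqrt z)) ∧
          z ^ (μ - 2) *
              (-Real.sqrt z / 2 + μ * (μ - 1)
                + (2 * μ - 1) * (2 * μ - 3) / (4 * Real.sqrt z)) ≤ 0) ∧
        (deriv (deriv (fun w : ℝ => w ^ (μ - 1/2) - w ^ μ)) z
            + deriv (fun w : ℝ => w ^ (μ - 1/2) - w ^ μ) z
            - (μ / z) * (z ^ (μ - 1/2) - z ^ μ)
          = z ^ (μ - 2) *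
              (-Real.sqrt z / 2 - μ * (μ - 1)
                + (2 * μ - 1) * (2 * μ - 3) / (4 * Real.sqrt z)) ∧
          z ^ (μ - 2) *
              (-Real.sqrt z / 2 - μ * (μ - 1)
                + (2 * μ - 1) * (2 * μ - 3) / (4 * Real.sqrt z)) ≤ 0)) := by
  refine ⟨(8 * Λ ^ 2) ^ 2, ?_, ?_⟩
  · have : 1 < Λ ^ 2 := by nlinarith
    nlinarith
  intro μ hμ z hz
  have hz0 : 0 < z := lt_of_lt_of_le (by positivity) hz
  have p1 := barrier_eq 1 μ z hz0
  have p2 := barrier_nonpos Λ 1 μ z hΛ (by simp) hμ hz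
  have m1 := barrier_eq (-1) μ z hz0
  have m2 := barrier_nonpos Λ (-1) μ z hΛ (by simp) hμ hz
  simp only [one_mul, neg_one_mul, ← sub_eq_add_neg] at p1 p2 m1 m2
  exact ⟨⟨p1, p2⟩, m1, m2⟩
end

section
/- For every Λ > 1 there exists a constant C(Λ) > 4 such that for every μ ∈ ℝ with |μ| < Λ there exists a function b : ℝ → ℝ, twice continuously differentiable on [C(Λ), ∞), which satisfies b''(z) + b'(z) − (μ/z)·b(z) = 0 for all z > C(Λ), together with the asymptotic bounds 1/2 ≤ 1 − z^{−1/2} ≤ b(z)·z^{−μ} ≤ 1 + z^{−1/2} ≤ 2 for all z ≥ C(Λ). -/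
open Set

open MeasureTheory intervalIntegral Filter Topology BoundedContinuousFunction

noncomputable section

def auxW (c μ s : ℝ) : ℝ := Real.exp s * (max s c) ^ (2 * μ - 2)

def auxV (c μ s : ℝ) : ℝ := Real.exp (-s) * (max s c) ^ (-(2 * μ))

def auxG (c μ : ℝ) (f : ℝ → ℝ) (s : ℝ) : ℝ :=
  -(μ * (μ - 1)) * auxV c μ s * ∫ t in c..s, auxW c μ t * f t

lemma auxW_cont {c : ℝ} (hc : 0 < c) (μ : ℝ) : Continuous (auxW c μ) := by
  unfold auxW
  refine Real.continuous_exp.mul (Continuous.rpow_const (by fun_prop) ?_)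
  intro x; left
  exact ne_of_gt (lt_of_lt_of_le hc (le_max_right x c))

lemma auxV_cont {c : ℝ} (hc : 0 < c) (μ : ℝ) : Continuous (auxV c μ) := by
  unfold auxV
  refine (by fun_prop : Continuous fun s : ℝ => Real.exp (-s)).mul
    (Continuous.rpow_const (by fun_prop) ?_)
  intro x; left
  exact ne_of_gt (lt_of_lt_of_le hc (le_max_right x c))

lemma auxG_cont {c : ℝ} (hc : 0 < c) (μ : ℝ) {f : ℝ → ℝ} (hf : Continuous f) :
    Continuous (auxG c μ f) := by
  unfold auxG
  refine (continuous_const.mul (auxV_cont hc μ)).mul ?_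
  exact intervalIntegral.continuous_primitive
    (fun a b => ((auxW_cont hc μ).mul hf).intervalIntegrable a b) c

lemma auxG_sub {c : ℝ} (hc : 0 < c) (μ : ℝ) {f g : ℝ → ℝ} (hf : Continuous f)
    (hg : Continuous g) (s : ℝ) :
    auxG c μ f s - auxG c μ g s = auxG c μ (fun t => f t - g t) s := by
  unfold auxG
  have h := intervalIntegral.integral_sub (μ := volume) (a := c) (b := s)
    (f := fun t => auxW c μ t * f t) (g := fun t => auxW c μ t * g t)
    (((auxW_cont hc μ).mul hf).intervalIntegrable _ _)
    (((auxW_cont hc μ).mul hg).intervalIntegrable _ _)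
  rw [← mul_sub, ← h]
  simp only [mul_sub]

lemma auxW_int {c : ℝ} (hc : 0 < c) (μ : ℝ) (h : 2 * |2 * μ - 2| ≤ c) {s : ℝ} (hs : c ≤ s) :
    ∫ t in c..s, auxW c μ t ≤ 2 * (Real.exp s * s ^ (2 * μ - 2)) := by
  have hd : ∀ x, 0 < x → HasDerivAt (fun s : ℝ => 2 * (Real.exp s * s ^ (2 * μ - 2)))
      (2 * (Real.exp x * x ^ (2 * μ - 2) + Real.exp x * ((2 * μ - 2) * x ^ (2 * μ - 2 - 1)))) x := by
    intro x hx
    exact (((Real.hasDerivAt_exp x).mul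
      (Real.hasDerivAt_rpow_const (Or.inl hx.ne'))).const_mul 2)
  have := intervalIntegral.integral_le_sub_of_hasDeriv_right_of_le
    (φ := auxW c μ) hs
    (fun x hx => (hd x (lt_of_lt_of_le hc hx.1)).continuousAt.continuousWithinAt)
    (fun x hx => (hd x (lt_trans hc hx.1)).hasDerivWithinAt)
    ((auxW_cont hc μ).integrableOn_Icc)
    (by
      intro x hx
      have hx0 : 0 < x := lt_trans hc hx.1
      unfold auxW
      rw [max_eq_left hx.1.le, Real.rpow_sub_one hx0.ne']
      have hp : 0 < x ^ (2 * μ - 2) := Real.rpow_pos_of_pos hx0 _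
      have he := Real.exp_pos x
      have h1 : -(1/2) ≤ (2 * μ - 2) / x := by
        rw [le_div_iff₀ hx0]
        have := neg_abs_le (2 * μ - 2)
        have := hx.1
        linarith
      have : 2 * (Real.exp x * x ^ (2 * μ - 2) + Real.exp x * ((2 * μ - 2) * (x ^ (2 * μ - 2) / x)))
        - Real.exp x * x ^ (2 * μ - 2)
        = 2 * (Real.exp x * x ^ (2 * μ - 2)) * ((2 * μ - 2) / x + 1 / 2) := by
        field_simp; ring
      have h2 : 0 ≤ 2 * (Real.exp x * x ^ (2 * μ - 2)) * ((2 * μ - 2) / x + 1 / 2) :=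
        mul_nonneg (by positivity) (by linarith)
      linarith)
  have h3 : 0 ≤ 2 * (Real.exp c * c ^ (2 * μ - 2)) := by positivity
  linarith

lemma auxG_bound {c : ℝ} (hc : 0 < c) (μ : ℝ) (h : 2 * |2 * μ - 2| ≤ c) {f : ℝ → ℝ}
    (hf : Continuous f) {M : ℝ} (hM : ∀ t, |f t| ≤ M) {s : ℝ} (hs : c ≤ s) :
    |auxG c μ f s| ≤ 2 * |μ * (μ - 1)| * M / s ^ 2 := by
  have hs0 : 0 < s := lt_of_lt_of_le hc hs
  have hM0 : 0 ≤ M := (abs_nonneg _).trans (hM 0)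
  have hWn : ∀ t, 0 ≤ auxW c μ t := fun t => by
    unfold auxW
    have : 0 < max t c := lt_of_lt_of_le hc (le_max_right _ _)
    positivity
  have h1 : |∫ t in c..s, auxW c μ t * f t| ≤ 2 * (Real.exp s * s ^ (2 * μ - 2)) * M := by
    calc |∫ t in c..s, auxW c μ t * f t| ≤ ∫ t in c..s, auxW c μ t * M := by
          have := intervalIntegral.norm_integral_le_of_norm_le (μ := volume) hs
            (f := fun t => auxW c μ t * f t) (g := fun t => auxW c μ t * M)
            (Eventually.of_forall (fun t _ => by
              rw [Real.norm_eq_abs, abs_mul, abs_of_nonneg (hWn t)]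
              exact mul_le_mul_of_nonneg_left (hM t) (hWn t)))
            (((auxW_cont hc μ).mul continuous_const).intervalIntegrable _ _)
          simpa using this
      _ = (∫ t in c..s, auxW c μ t) * M := by rw [intervalIntegral.integral_mul_const]
      _ ≤ _ := mul_le_mul_of_nonneg_right (auxW_int hc μ h hs) hM0
  have hV : 0 < auxV c μ s := by
    unfold auxV
    have : 0 < max s c := lt_of_lt_of_le hc (le_max_right _ _)
    positivity
  have hVW : auxV c μ s * (Real.exp s * s ^ (2 * μ - 2)) = 1 / s ^ 2 := by
    unfold auxV
    rw [max_eq_left hs]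
    have e1 : s ^ (2 * μ - 2) = s ^ (2 * μ) / s ^ 2 := by
      rw [Real.rpow_sub hs0]; norm_num
    rw [e1, Real.rpow_neg hs0.le, Real.exp_neg]
    have := Real.exp_pos s
    have := Real.rpow_pos_of_pos hs0 (2 * μ)
    field_simp
  unfold auxG
  rw [abs_mul, abs_mul, abs_neg, abs_of_pos hV]
  calc |μ * (μ - 1)| * auxV c μ s * |∫ t in c..s, auxW c μ t * f t|
      ≤ |μ * (μ - 1)| * auxV c μ s * (2 * (Real.exp s * s ^ (2 * μ - 2)) * M) :=
        mul_le_mul_of_nonneg_left h1 (by positivity)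
    _ = 2 * |μ * (μ - 1)| * M * (auxV c μ s * (Real.exp s * s ^ (2 * μ - 2))) := by ring
    _ = _ := by rw [hVW]; ring

lemma auxI_bound {c : ℝ} (hc : 0 < c) (μ : ℝ) (h : 2 * |2 * μ - 2| ≤ c) {f : ℝ → ℝ}
    (hf : Continuous f) {M : ℝ} (hM : ∀ t, |f t| ≤ M) {x y : ℝ} (hx : c ≤ x) (hxy : x ≤ y) :
    |∫ s in x..y, auxG c μ f s| ≤ 2 * |μ * (μ - 1)| * M / x := by
  have hx0 : 0 < x := lt_of_lt_of_le hc hx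
  have hM0 : 0 ≤ M := (abs_nonneg _).trans (hM 0)
  set A := 2 * |μ * (μ - 1)| * M with hA
  have hA0 : 0 ≤ A := by positivity
  have hcont : ContinuousOn (fun s : ℝ => A / s ^ 2) (uIcc x y) := by
    intro t ht
    rw [uIcc_of_le hxy] at ht
    have : t ≠ 0 := (lt_of_lt_of_le hx0 ht.1).ne'
    exact (ContinuousAt.div continuousAt_const (by fun_prop) (by positivity)).continuousWithinAt
  have h1 := intervalIntegral.norm_integral_le_of_norm_le (μ := volume) hxy
            (f := fun t => auxG c μ f t) (g := fun t => A / t ^ 2)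
            (Eventually.of_forall (fun t ht => by
              rw [Real.norm_eq_abs]
              exact auxG_bound hc μ h hf hM (hx.trans ht.1.le)))
            hcont.intervalIntegrable
  have h2 : ∫ s in x..y, A / s ^ 2 = (-A / y) - (-A / x) := by
    refine intervalIntegral.integral_eq_sub_of_hasDerivAt (f := fun s => -A / s) ?_
      hcont.intervalIntegrable
    intro t ht
    rw [uIcc_of_le hxy] at ht
    have ht0 : t ≠ 0 := (lt_of_lt_of_le hx0 ht.1).ne'
    have h3 := (hasDerivAt_inv ht0).const_mul (-A)
    simp only [div_eq_mul_inv]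
    refine h3.congr_deriv ?_
    field_simp
  rw [h2, Real.norm_eq_abs] at h1
  have : 0 ≤ A / y := div_nonneg hA0 (hx0.le.trans hxy)
  have e : (-A / y) - (-A / x) = A / x - A / y := by ring
  linarith

lemma aux_fixed {c : ℝ} (hc : 0 < c) (μ : ℝ) (h : 2 * |2 * μ - 2| ≤ c)
    (hk : 4 * |μ * (μ - 1)| ≤ c) :
    ∃ f : ℝ → ℝ, Continuous f ∧ (∀ t, |f t| ≤ 2) ∧
      ∀ z, c ≤ z → f z = 1 + ∫ s in c..z, auxG c μ f s := by
  have key : ∀ (f : ℝ → ℝ), Continuous f → ∀ M, (∀ t, |f t| ≤ M) → ∀ z,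
      |∫ s in c..max z c, auxG c μ f s| ≤ M / 2 := by
    intro f hf M hM z
    have hM0 : 0 ≤ M := (abs_nonneg _).trans (hM 0)
    refine (auxI_bound hc μ h hf hM le_rfl (le_max_right _ _)).trans ?_
    rw [div_le_iff₀ hc]
    nlinarith
  have hTc : ∀ f : ℝ →ᵇ ℝ, Continuous fun z => 1 + ∫ s in c..max z c, auxG c μ f s := by
    intro f
    have := intervalIntegral.continuous_primitive (μ := volume)
      (fun a b => (auxG_cont hc μ f.continuous).intervalIntegrable a b) c
    exact continuous_const.add (this.comp (continuous_id.max continuous_const))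
  have hfb : ∀ (f : ℝ →ᵇ ℝ) t, |f t| ≤ ‖f‖ := fun f t => f.norm_coe_le_norm t
  let T : (ℝ →ᵇ ℝ) → (ℝ →ᵇ ℝ) := fun f =>
    BoundedContinuousFunction.ofNormedAddCommGroup
      (fun z => 1 + ∫ s in c..max z c, auxG c μ f s) (hTc f) (1 + ‖f‖ / 2) (by
        intro z
        refine (norm_add_le _ _).trans ?_
        have := key f f.continuous _ (hfb f) z
        simpa using this)
  have hT : ∀ f z, T f z = 1 + ∫ s in c..max z c, auxG c μ f s := fun f z => rfl
  have hcon : ContractingWith (1/2) T := by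
    refine ⟨by norm_num, LipschitzWith.of_dist_le_mul ?_⟩
    intro f g
    rw [BoundedContinuousFunction.dist_le (by positivity)]
    intro z
    rw [hT, hT, Real.dist_eq, add_sub_add_left_eq_sub, ← intervalIntegral.integral_sub
      ((auxG_cont hc μ f.continuous).intervalIntegrable _ _)
      ((auxG_cont hc μ g.continuous).intervalIntegrable _ _)]
    simp_rw [auxG_sub hc μ f.continuous g.continuous]
    have := key (fun t => f t - g t) (f.continuous.sub g.continuous) (dist f g) (fun t => by
      rw [← Real.dist_eq]; exact f.dist_coe_le_dist t) z
    refine this.trans (le_of_eq ?_)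
    push_cast; ring
  have hfix := hcon.fixedPoint_isFixedPt
  set f := hcon.fixedPoint T
  have hf : ∀ z, f z = 1 + ∫ s in c..max z c, auxG c μ f s := fun z => by
    rw [← hT, hfix]
  have hn : ‖f‖ ≤ 1 + ‖f‖ / 2 := by
    rw [BoundedContinuousFunction.norm_le (by positivity)]
    intro z
    rw [hf z]
    refine (norm_add_le _ _).trans ?_
    have := key f f.continuous _ (hfb f) z
    simpa using this
  refine ⟨f, f.continuous, fun t => (hfb f t).trans (by linarith), fun z hz => ?_⟩
  rw [hf z, max_eq_left hz]

lemma aux_F {c : ℝ} (hc : 0 < c) (μ : ℝ) (h : 2 * |2 * μ - 2| ≤ c)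
    (hk : 8 * |μ * (μ - 1)| ≤ c) :
    ∃ F G : ℝ → ℝ, (∀ z, HasDerivAt F (G z) z) ∧
      (∀ z, c < z → HasDerivAt G (-(1 + 2 * μ / z) * G z - μ * (μ - 1) / z ^ 2 * F z) z) ∧
      ∀ z, c ≤ z → |F z - 1| ≤ 8 * |μ * (μ - 1)| / z := by
  obtain ⟨f, hf, hfM, hfe⟩ := aux_fixed hc μ h (by linarith [abs_nonneg (μ * (μ - 1))])
  have hGc := auxG_cont hc μ hf
  set k := μ * (μ - 1) with hkdef
  have hk0 : 0 ≤ |k| := abs_nonneg k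
  have hdF : ∀ z, HasDerivAt (fun z => 1 + ∫ s in c..z, auxG c μ f s) (auxG c μ f z) z := by
    intro z
    exact (intervalIntegral.integral_hasDerivAt_right (hGc.intervalIntegrable _ _)
      (hGc.stronglyMeasurableAtFilter _ _) hGc.continuousAt).const_add 1
  have hcont : Continuous fun z => 1 + ∫ s in c..z, auxG c μ f s :=
    continuous_iff_continuousAt.2 fun z => (hdF z).continuousAt
  set F := fun z => 1 + ∫ s in c..z, auxG c μ f s with hF
  have hFf : ∀ z, c ≤ z → F z = f z := fun z hz => (hfe z hz).symm
  have hdiff : ∀ x y, c ≤ x → x ≤ y → |F y - F x| ≤ 4 * |k| / x := by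
    intro x y hx hxy
    have := auxI_bound hc μ h hf hfM hx hxy
    have e : F y - F x = ∫ s in x..y, auxG c μ f s := by
      simp only [hF, add_sub_add_left_eq_sub]
      exact intervalIntegral.integral_interval_sub_left (hGc.intervalIntegrable _ _)
        (hGc.intervalIntegrable _ _)
    rw [e]
    refine this.trans (le_of_eq (by ring))
  have hdG : ∀ z, c < z → HasDerivAt (auxG c μ f)
      (-(1 + 2 * μ / z) * auxG c μ f z - k / z ^ 2 * F z) z := by
    intro z hz
    have hz0 : 0 < z := hc.trans hz
    have hWc : Continuous fun t => auxW c μ t * f t := (auxW_cont hc μ).mul hf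
    have h1 := intervalIntegral.integral_hasDerivAt_right (a := c) (b := z)
      (hWc.intervalIntegrable _ _) (hWc.stronglyMeasurableAtFilter _ _) hWc.continuousAt
    have h2 : HasDerivAt (fun s : ℝ => Real.exp (-s) * s ^ (-(2 * μ)))
        (Real.exp (-z) * (-1) * z ^ (-(2 * μ)) +
          Real.exp (-z) * ((-(2 * μ)) * z ^ (-(2 * μ) - 1))) z :=
      ((hasDerivAt_neg z).exp).mul (Real.hasDerivAt_rpow_const (Or.inl hz0.ne'))
    have hev : auxV c μ =ᶠ[𝓝 z] fun s : ℝ => Real.exp (-s) * s ^ (-(2 * μ)) := by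
      filter_upwards [lt_mem_nhds hz] with s hs
      simp only [auxV, max_eq_left hs.le]
    have h3 := ((h2.congr_of_eventuallyEq hev).const_mul (-(μ * (μ - 1)))).mul h1
    refine h3.congr_deriv ?_
    rw [hFf z hz.le]
    unfold auxG
    set I := ∫ t in c..z, auxW c μ t * f t
    simp only [auxV, auxW, max_eq_left hz.le]
    rw [Real.rpow_sub_one hz0.ne']
    have e1 : z ^ (2 * μ - 2) = z ^ (2 * μ) / z ^ 2 := by
      rw [Real.rpow_sub hz0]; norm_num
    rw [e1, Real.rpow_neg hz0.le, Real.exp_neg]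
    have := Real.exp_pos z
    have := Real.rpow_pos_of_pos hz0 (2 * μ)
    rw [hkdef]
    field_simp
    ring
  -- the limit
  have hcau : CauchySeq F := by
    rw [Metric.cauchySeq_iff']
    intro ε hε
    refine ⟨max c (4 * |k| / ε + 1), fun n hn => ?_⟩
    rw [Real.dist_eq]
    refine lt_of_le_of_lt (hdiff _ _ (le_max_left _ _) hn) ?_
    have h0 : 0 < max c (4 * |k| / ε + 1) := lt_of_lt_of_le hc (le_max_left _ _)
    rw [div_lt_iff₀ h0, ← div_lt_iff₀' hε]
    exact lt_of_lt_of_le (by linarith) (le_max_right _ _)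
  obtain ⟨L, hL⟩ := cauchySeq_tendsto_of_complete hcau
  have hLd : ∀ x, c ≤ x → |L - F x| ≤ 4 * |k| / x := by
    intro x hx
    refine le_of_tendsto ((hL.sub_const (F x)).abs) ?_
    filter_upwards [eventually_ge_atTop x] with y hy
    exact hdiff x y hx hy
  have hLh : 1 / 2 ≤ L := by
    have h1 := hLd c le_rfl
    have h2 : F c = 1 := by simp [hF]
    have h3 : 4 * |k| / c ≤ 1 / 2 := by rw [div_le_iff₀ hc]; linarith
    rw [h2] at h1
    have := neg_abs_le (L - 1)
    linarith
  have hL0 : 0 < L := by linarith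
  refine ⟨fun z => F z / L, fun z => auxG c μ f z / L, fun z => (hdF z).div_const L, ?_, ?_⟩
  · intro z hz
    refine ((hdG z hz).div_const L).congr_deriv ?_
    ring
  · intro z hz
    have hz0 : 0 < z := lt_of_lt_of_le hc hz
    have h1 := hLd z hz
    have e : F z / L - 1 = -(L - F z) / L := by field_simp; ring
    simp only [e]
    rw [abs_div, abs_neg, abs_of_pos hL0, div_le_iff₀ hL0]
    refine h1.trans ?_
    have : 0 ≤ 8 * |k| / z := by positivity
    have e2 : 4 * |k| / z = 8 * |k| / z * (1 / 2) := by ring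
    rw [e2]
    exact mul_le_mul_of_nonneg_left hLh this

end

/-- for every `Λ > 1` there is `C(Λ) > 4` such that for every `|μ| < Λ`
there is a solution `b` of `b'' + b' − (μ/z)b = 0` on `(C,∞)`, twice continuously
differentiable on `[C,∞)`, with `1/2 ≤ 1 − z^{−1/2} ≤ b(z)·z^{−μ} ≤ 1 + z^{−1/2} ≤ 2`
for all `z ≥ C`. -/
theorem solution_asymptotic_to_z_pow_mu (Λ : ℝ) (hΛ : Λ > 1) :
    ∃ C : ℝ, C > 4 ∧
      ∀ μ : ℝ, |μ| < Λ →
        ∃ b : ℝ → ℝ, ContDiffOn ℝ 2 b (Ici C) ∧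
          (∀ z : ℝ, z > C → deriv (deriv b) z + deriv b z - (μ / z) * b z = 0) ∧
          ∀ z : ℝ, z ≥ C →
            (1 / 2 : ℝ) ≤ 1 - z ^ (-(1 : ℝ) / 2) ∧
            1 - z ^ (-(1 : ℝ) / 2) ≤ b z * z ^ (-μ) ∧
            b z * z ^ (-μ) ≤ 1 + z ^ (-(1 : ℝ) / 2) ∧
            1 + z ^ (-(1 : ℝ) / 2) ≤ 2 := by
  have hΛ2 : 1 < Λ ^ 2 := by nlinarith
  have hΛ4 : Λ ^ 2 < Λ ^ 4 := by nlinarith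
  have hΛΛ : Λ < Λ ^ 2 := by nlinarith
  refine ⟨256 * Λ ^ 4 + 1, by nlinarith, ?_⟩
  intro μ hμ
  have hμ' := abs_lt.1 hμ
  set c : ℝ := 256 * Λ ^ 4 with hcdef
  have hc : 0 < c := by positivity
  have h1 : 2 * |2 * μ - 2| ≤ c := by
    have : |2 * μ - 2| ≤ 2 * Λ + 2 := by rw [abs_le]; constructor <;> linarith
    linarith
  have hk : |μ * (μ - 1)| ≤ 2 * Λ ^ 2 := by
    rw [abs_mul]
    have : |μ - 1| ≤ 2 * Λ := by rw [abs_le]; constructor <;> linarith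
    calc |μ| * |μ - 1| ≤ Λ * (2 * Λ) := mul_le_mul hμ.le this (abs_nonneg _) (by linarith)
      _ = _ := by ring
  obtain ⟨F, G, hF, hG, hb⟩ := aux_F hc μ h1 (by linarith)
  have hp : ∀ (a z : ℝ), c < z → HasDerivAt (fun z : ℝ => z ^ a) (a * z ^ (a - 1)) z :=
    fun a z hz => Real.hasDerivAt_rpow_const (Or.inl (hc.trans hz).ne')
  have hd1 : ∀ z, c < z → HasDerivAt (fun z => z ^ μ * F z)
      (μ * z ^ (μ - 1) * F z + z ^ μ * G z) z := fun z hz => (hp μ z hz).mul (hF z)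
  have hd2 : ∀ z, c < z → HasDerivAt (fun z => μ * z ^ (μ - 1) * F z + z ^ μ * G z)
      ((μ * ((μ - 1) * z ^ (μ - 1 - 1)) * F z + μ * z ^ (μ - 1) * G z) +
       (μ * z ^ (μ - 1) * G z + z ^ μ * (-(1 + 2 * μ / z) * G z - μ * (μ - 1) / z ^ 2 * F z))) z :=
    fun z hz => (((hp (μ - 1) z hz).const_mul μ).mul (hF z)).add ((hp μ z hz).mul (hG z hz))
  have hdd : ∀ z, c < z → deriv (deriv (fun z => z ^ μ * F z)) z =
      ((μ * ((μ - 1) * z ^ (μ - 1 - 1)) * F z + μ * z ^ (μ - 1) * G z) +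
       (μ * z ^ (μ - 1) * G z + z ^ μ * (-(1 + 2 * μ / z) * G z - μ * (μ - 1) / z ^ 2 * F z))) := by
    intro z hz
    have hev : deriv (fun z => z ^ μ * F z) =ᶠ[𝓝 z]
        fun z => μ * z ^ (μ - 1) * F z + z ^ μ * G z := by
      filter_upwards [lt_mem_nhds hz] with s hs using (hd1 s hs).deriv
    exact ((hd2 z hz).congr_of_eventuallyEq hev).deriv
  have hode : ∀ z, c < z → deriv (deriv (fun z => z ^ μ * F z)) z +
      deriv (fun z => z ^ μ * F z) z - (μ / z) * (z ^ μ * F z) = 0 := by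
    intro z hz
    have hz0 : 0 < z := hc.trans hz
    rw [hdd z hz, (hd1 z hz).deriv, Real.rpow_sub_one hz0.ne', Real.rpow_sub_one hz0.ne']
    field_simp
    ring
  refine ⟨fun z => z ^ μ * F z, ?_, ?_, ?_⟩
  · refine ContDiffOn.mono (s := Ioi c) ?_ (fun z hz => by
      simp only [mem_Ici] at hz; simp only [mem_Ioi]; linarith)
    have hrp : ContDiffOn ℝ 2 (fun z : ℝ => z ^ μ) (Ioi c) := fun z hz =>
      (Real.contDiffAt_rpow_const_of_ne (hc.trans hz).ne').contDiffWithinAt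
    refine hrp.mul ?_
    have hFc : Continuous F := continuous_iff_continuousAt.2 fun z => (hF z).continuousAt
    have hFd : deriv F = G := funext fun z => (hF z).deriv
    have hGd : DifferentiableOn ℝ G (Ioi c) := fun z hz =>
      (hG z hz).differentiableAt.differentiableWithinAt
    have hG1 : ContDiffOn ℝ 1 G (Ioi c) := by
      rw [show (1 : WithTop ℕ∞) = 0 + 1 by norm_num, contDiffOn_succ_iff_deriv_of_isOpen isOpen_Ioi]
      refine ⟨hGd, by simp, ?_⟩
      rw [contDiffOn_zero]
      have : ContinuousOn (fun z => -(1 + 2 * μ / z) * G z - μ * (μ - 1) / z ^ 2 * F z) (Ioi c) := by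
        have hne : ∀ z ∈ Ioi c, z ≠ 0 := fun z hz => (hc.trans hz).ne'
        have hGc := hGd.continuousOn
        have hFc' := hFc.continuousOn (s := Ioi c)
        have hi : ContinuousOn (fun z : ℝ => 2 * μ / z) (Ioi c) :=
          continuousOn_const.div continuousOn_id hne
        have hi2 : ContinuousOn (fun z : ℝ => μ * (μ - 1) / z ^ 2) (Ioi c) :=
          continuousOn_const.div (continuousOn_id.pow 2) (fun z hz => pow_ne_zero 2 (hne z hz))
        exact ((continuousOn_const.add hi).neg.mul hGc).sub (hi2.mul hFc')
      exact this.congr fun z hz => (hG z hz).deriv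
    rw [show (2 : WithTop ℕ∞) = 1 + 1 by norm_num, contDiffOn_succ_iff_deriv_of_isOpen isOpen_Ioi]
    refine ⟨fun z _ => (hF z).differentiableAt.differentiableWithinAt, by simp, ?_⟩
    rw [hFd]; exact hG1
  · intro z hz
    exact hode z (by linarith)
  · intro z hz
    have hzc : c ≤ z := by linarith
    have hz0 : 0 < z := lt_of_lt_of_le hc hzc
    have hs : z ^ (-(1 : ℝ) / 2) = 1 / √z := by
      rw [Real.sqrt_eq_rpow, neg_div, Real.rpow_neg hz0.le, inv_eq_one_div]
    have hbz : z ^ μ * F z * z ^ (-μ) = F z := by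
      rw [Real.rpow_neg hz0.le]
      have := Real.rpow_pos_of_pos hz0 μ
      field_simp
    have hsq : 16 * Λ ^ 2 ≤ √z := by
      apply Real.le_sqrt_of_sq_le
      calc (16 * Λ ^ 2) ^ 2 = c := by rw [hcdef]; ring
        _ ≤ z := hzc
    have hsp : 0 < √z := Real.sqrt_pos.2 hz0
    have hhalf : 1 / √z ≤ 1 / 2 := one_div_le_one_div_of_le (by norm_num) (by linarith)
    have hB : |F z - 1| ≤ 1 / √z := by
      refine (hb z hzc).trans ?_
      rw [div_le_div_iff₀ hz0 hsp]
      calc 8 * |μ * (μ - 1)| * √z ≤ √z * √z :=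
            mul_le_mul_of_nonneg_right (by linarith) hsp.le
        _ = 1 * z := by rw [Real.mul_self_sqrt hz0.le, one_mul]
    simp only [hbz, hs]
    have := abs_le.1 hB
    refine ⟨?_, ?_, ?_, ?_⟩ <;> linarith
end

section
/- For every Λ > 0 there exists a constant C(Λ) > 1 such that for every μ ≥ −Λ and every z₀ ≥ C(Λ) there exists a unique function w, twice continuously differentiable on [z₀,∞), satisfying w''(z) + w'(z) − (μ/z)·w(z) = 0 for z > z₀, w(z₀) = 1, and ∫_{z₀}^∞ w(s)²·e^s ds < +∞. Moreover, w satisfies 0 < w(z) ≤ e^{z₀−z}·(z/z₀)^{1+max(−μ,0)} for all z ≥ z₀, and |w'(z₀)| ≤ 2 + max(μ,0). -/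
open MeasureTheory Set

lemma S_bound {a : ℝ} (ha : 0 < a) {H : ℝ → ℝ} {M : ℝ} (hb : ∀ s, |H s| ≤ M) (z : ℝ) :
    |Real.exp (a * z) * ∫ s in Ioi z, Real.exp (-a * s) * H s| ≤ M / a := by
  have hint : IntegrableOn (fun s => Real.exp (-a * s) * M) (Ioi z) :=
    (integrableOn_exp_mul_Ioi (by linarith) z).mul_const M
  have h1 : ‖∫ s in Ioi z, Real.exp (-a * s) * H s‖ ≤ ∫ s in Ioi z, Real.exp (-a * s) * M := by
    apply norm_integral_le_of_norm_le hint
    refine Filter.Eventually.of_forall fun s => ?_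
    rw [norm_mul, Real.norm_eq_abs, Real.norm_eq_abs, abs_of_pos (Real.exp_pos _)]
    exact mul_le_mul_of_nonneg_left (hb s) (Real.exp_pos _).le
  rw [integral_mul_const, integral_exp_mul_Ioi (by linarith) z] at h1
  rw [abs_mul, abs_of_pos (Real.exp_pos _)]
  rw [Real.norm_eq_abs] at h1
  calc _ ≤ Real.exp (a * z) * (-Real.exp (-a * z) / -a * M) :=
        mul_le_mul_of_nonneg_left h1 (Real.exp_pos _).le
    _ = (Real.exp (a * z) * Real.exp (-a * z)) * M / a := by field_simp
    _ = M / a := by rw [← Real.exp_add]; simp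

lemma S_int {a : ℝ} (ha : 0 < a) {H : ℝ → ℝ} (hc : Continuous H) {M : ℝ}
    (hb : ∀ s, |H s| ≤ M) (z : ℝ) :
    IntegrableOn (fun s => Real.exp (-a * s) * H s) (Ioi z) := by
  have hint : IntegrableOn (fun s => Real.exp (-a * s) * M) (Ioi z) :=
    (integrableOn_exp_mul_Ioi (by linarith) z).mul_const M
  refine Integrable.mono' hint ?_ ?_
  · exact Continuous.aestronglyMeasurable (by fun_prop)
  · refine Filter.Eventually.of_forall fun s => ?_
    rw [norm_mul, Real.norm_eq_abs, Real.norm_eq_abs, abs_of_pos (Real.exp_pos _)]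
    exact mul_le_mul_of_nonneg_left (hb s) (Real.exp_pos _).le

lemma S_deriv {a : ℝ} (ha : 0 < a) {H : ℝ → ℝ} (hc : Continuous H) {M : ℝ}
    (hb : ∀ s, |H s| ≤ M) (z : ℝ) :
    HasDerivAt (fun z => Real.exp (a * z) * ∫ s in Ioi z, Real.exp (-a * s) * H s)
      (a * (Real.exp (a * z) * ∫ s in Ioi z, Real.exp (-a * s) * H s) - H z) z := by
  have hcc : Continuous (fun s => Real.exp (-a * s) * H s) := by fun_prop
  have heq : ∀ y, ∫ s in Ioi y, Real.exp (-a * s) * H s =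
      (∫ s in Ioi (0:ℝ), Real.exp (-a * s) * H s) - ∫ s in (0:ℝ)..y, Real.exp (-a * s) * H s := by
    intro y
    have := intervalIntegral.integral_interval_add_Ioi (S_int ha hc hb 0) (S_int ha hc hb y)
    linarith
  have hd : HasDerivAt (fun y => ∫ s in Ioi y, Real.exp (-a * s) * H s)
      (-(Real.exp (-a * z) * H z)) z := by
    rw [funext heq]
    exact (hcc.integral_hasStrictDerivAt 0 z).hasDerivAt.const_sub _
  have he : HasDerivAt (fun z => Real.exp (a * z)) (Real.exp (a * z) * a) z := by
    simpa using ((hasDerivAt_id z).const_mul a).exp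
  refine (he.mul hd).congr_deriv ?_
  have : Real.exp (a * z) * Real.exp (-a * z) = 1 := by rw [← Real.exp_add]; simp
  linear_combination (-H z) * this

/-- Bounded solution of a Riccati equation between barriers. -/
lemma riccati (K z₀ : ℝ) (hK : 1 ≤ K) (k σ : ℝ → ℝ) (hk : Continuous k) (hσ : Continuous σ)
    (hk0 : ∀ s, 0 ≤ k s) (hkK : ∀ s, k s ≤ K ^ 2) (hσ0 : ∀ s, 1 / 4 ≤ σ s) (hσK : ∀ s, σ s ≤ K)
    (σ' : ℝ → ℝ) (hσ' : ∀ z > z₀, HasDerivAt σ (σ' z) z)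
    (hsub : ∀ z > z₀, σ z ^ 2 - k z ≤ σ' z) :
    ∃ p p' : ℝ → ℝ, Continuous p' ∧ (∀ z, HasDerivAt p (p' z) z) ∧
      (∀ z ≥ z₀, σ z ≤ p z ∧ p z ≤ K ∧ p' z = p z ^ 2 - k z) := by
  set c : ℝ → ℝ → ℝ := fun s x => max (σ s) (min x K) with hc
  have c1 : ∀ s x, σ s ≤ c s x := fun s x => le_max_left _ _
  have c2 : ∀ s x, c s x ≤ K := fun s x => max_le (hσK s) (min_le_right _ _)
  have c3 : ∀ s x y, |c s x - c s y| ≤ |x - y| := by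
    intro s x y
    refine (abs_max_sub_max_le_max _ _ _ _).trans ?_
    refine max_le (by simp) ?_
    refine (abs_min_sub_min_le_max _ _ _ _).trans ?_
    simp
  set F : ℝ → ℝ → ℝ := fun s x => 2 * K * c s x - c s x ^ 2 + k s with hF
  have F1 : ∀ s x, |F s x| ≤ 2 * K ^ 2 := by
    intro s x
    have h1 := c1 s x; have h2 := c2 s x; have h3 := hσ0 s; have := hk0 s; have := hkK s
    rw [abs_le]; simp only [hF]
    constructor <;> nlinarith [sq_nonneg (K - c s x)]
  have F2 : ∀ s x y, |F s x - F s y| ≤ (2 * K - 1 / 2) * |x - y| := by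
    intro s x y
    have h1 := c1 s x; have h2 := c2 s x; have h3 := hσ0 s
    have h1' := c1 s y; have h2' := c2 s y
    have : F s x - F s y = (2 * K - c s x - c s y) * (c s x - c s y) := by simp only [hF]; ring
    rw [this, abs_mul]
    refine mul_le_mul ?_ (c3 s x y) (abs_nonneg _) (by linarith)
    rw [abs_le]; constructor <;> linarith
  have F3 : ∀ f : ℝ → ℝ, Continuous f → Continuous (fun s => F s (f s)) := by
    intro f hf; simp only [hF, hc]; fun_prop
  have hK2 : 0 < 2 * K := by linarith
  let T : BoundedContinuousFunction ℝ ℝ → BoundedContinuousFunction ℝ ℝ := fun f =>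
    BoundedContinuousFunction.ofNormedAddCommGroup
      (fun z => Real.exp (2 * K * z) * ∫ s in Ioi z, Real.exp (-(2 * K) * s) * F s (f s))
      (continuous_iff_continuousAt.2 fun z =>
        (S_deriv hK2 (F3 f f.continuous) (fun s => F1 s (f s)) z).continuousAt)
      (2 * K ^ 2 / (2 * K)) (fun z => S_bound hK2 (fun s => F1 s (f s)) z)
  have hT : ∀ f z, T f z =
    Real.exp (2 * K * z) * ∫ s in Ioi z, Real.exp (-(2 * K) * s) * F s (f s) := fun _ _ => rfl
  have hq : 0 ≤ (2 * K - 1 / 2) / (2 * K) := div_nonneg (by linarith) hK2.le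
  have hcon : ContractingWith (Real.toNNReal ((2 * K - 1 / 2) / (2 * K))) T := by
    refine ⟨?_, LipschitzWith.of_dist_le_mul fun f g => ?_⟩
    · rw [← NNReal.coe_lt_coe, Real.coe_toNNReal _ hq, NNReal.coe_one]
      rw [div_lt_one hK2]; linarith
    · rw [BoundedContinuousFunction.dist_le (by positivity)]
      intro z
      rw [Real.dist_eq, hT, hT, ← mul_sub, ← integral_sub
        (S_int hK2 (F3 f f.continuous) (fun s => F1 s (f s)) z)
        (S_int hK2 (F3 g g.continuous) (fun s => F1 s (g s)) z)]
      simp only [← mul_sub]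
      refine (S_bound hK2 (M := (2 * K - 1 / 2) * dist f g) (fun s => ?_) z).trans ?_
      · refine (F2 _ _ _).trans ?_
        refine mul_le_mul_of_nonneg_left ?_ (by linarith)
        rw [← Real.dist_eq]
        exact BoundedContinuousFunction.dist_coe_le_dist s
      · rw [Real.coe_toNNReal _ hq]
        apply le_of_eq; ring
  obtain ⟨p, hp⟩ : ∃ p, T p = p := ⟨_, hcon.fixedPoint_isFixedPt⟩
  have hpd : ∀ z, HasDerivAt p (2 * K * p z - F z (p z)) z := by
    intro z
    have := S_deriv hK2 (F3 p p.continuous) (fun s => F1 s (p s)) z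
    rw [← hT, hp] at this
    have h2 : (fun z => Real.exp (2 * K * z) *
      ∫ s in Ioi z, Real.exp (-(2 * K) * s) * F s (p s)) = p := by
      funext y; rw [← hT, hp]
    rwa [h2] at this
  have hpb : ∀ z, |p z| ≤ ‖p‖ := fun z => p.norm_coe_le_norm z
  -- sign lemma
  have key : ∀ D D' : ℝ → ℝ, Continuous D → (∀ z > z₀, HasDerivAt D (D' z) z) →
      (∀ z > z₀, D' z ≤ 2 * K * D z) → (∃ B, ∀ z, |D z| ≤ B) → ∀ z ≥ z₀, 0 ≤ D z := by
    intro D D' hDc hD hle ⟨B, hB⟩ z hz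
    have he : ∀ x, HasDerivAt (fun z => Real.exp (-(2 * K) * z))
        (Real.exp (-(2 * K) * x) * (-(2 * K))) x := fun x => by
      simpa using ((hasDerivAt_id x).const_mul (-(2 * K))).exp
    have hanti : AntitoneOn (fun z => Real.exp (-(2 * K) * z) * D z) (Ici z₀) := by
      apply antitoneOn_of_hasDerivWithinAt_nonpos (convex_Ici z₀)
        (f' := fun x => Real.exp (-(2 * K) * x) * (-(2 * K)) * D x
          + Real.exp (-(2 * K) * x) * D' x)
      · exact Continuous.continuousOn (by fun_prop)
      · intro x hx
        rw [interior_Ici] at hx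
        exact ((he x).mul (hD x hx)).hasDerivWithinAt
      · intro x hx
        rw [interior_Ici] at hx
        have := hle x hx
        have h2 := Real.exp_pos (-(2 * K) * x)
        nlinarith
    have hlim : Filter.Tendsto (fun z => Real.exp (-(2 * K) * z) * D z) Filter.atTop (nhds 0) := by
      have h0 : Filter.Tendsto (fun z : ℝ => Real.exp (-(2 * K) * z)) Filter.atTop (nhds 0) := by
        apply Real.tendsto_exp_atBot.comp
        exact Filter.tendsto_id.const_mul_atTop_of_neg (by linarith)
      refine squeeze_zero_norm (a := fun z => Real.exp (-(2 * K) * z) * B) (fun x => ?_) ?_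
      · rw [norm_mul, Real.norm_eq_abs, Real.norm_eq_abs, abs_of_pos (Real.exp_pos _)]
        exact mul_le_mul_of_nonneg_left (hB x) (Real.exp_pos _).le
      · simpa using h0.mul_const B
    have hge : 0 ≤ Real.exp (-(2 * K) * z) * D z := by
      refine le_of_tendsto hlim ?_
      filter_upwards [Filter.eventually_ge_atTop z] with x hx
      exact hanti (mem_Ici.2 hz) (mem_Ici.2 (le_trans hz hx)) hx
    exact nonneg_of_mul_nonneg_right hge (Real.exp_pos _)
  have hlow : ∀ z ≥ z₀, 0 ≤ p z - σ z := by
    refine key (fun z => p z - σ z) (fun z => 2 * K * p z - F z (p z) - σ' z)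
      (p.continuous.sub hσ) (fun z hz => (hpd z).sub (hσ' z hz)) ?_ ⟨‖p‖ + K, fun z => ?_⟩
    · intro z hz
      have h1 := c1 z (p z); have h2 := c2 z (p z); have h3 := hσ0 z; have h4 := hsub z hz
      simp only [hF]
      nlinarith [mul_nonneg (sub_nonneg.2 h1) (sub_nonneg.2 h2),
        mul_nonneg (sub_nonneg.2 h1) (sub_nonneg.2 (hσK z))]
    · refine (abs_sub _ _).trans (add_le_add (hpb z) ?_)
      rw [abs_of_nonneg (by linarith [hσ0 z])]; exact hσK z
  have hup : ∀ z ≥ z₀, 0 ≤ K - p z := by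
    refine key (fun z => K - p z) (fun z => -(2 * K * p z - F z (p z)))
      (continuous_const.sub p.continuous) (fun z hz => (hpd z).const_sub K) ?_
      ⟨K + ‖p‖, fun z => ?_⟩
    · intro z hz
      have := hkK z
      simp only [hF]
      nlinarith [sq_nonneg (K - c z (p z))]
    · refine (abs_sub _ _).trans (add_le_add ?_ (hpb z))
      rw [abs_of_nonneg (by linarith)]
  refine ⟨p, fun z => 2 * K * p z - F z (p z), ?_, hpd, fun z hz => ?_⟩
  · exact (continuous_const.mul p.continuous).sub (F3 p p.continuous)
  · have h1 := hlow z hz; have h2 := hup z hz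
    refine ⟨by linarith, by linarith, ?_⟩
    have : c z (p z) = p z := by
      simp only [hc]; rw [min_eq_left (by linarith), max_eq_right (by linarith)]
    simp only [hF, this]; ring

/-- Uniqueness. -/
lemma uniq (μ z₀ : ℝ) (hz₀ : 0 < z₀) (hμ : ∀ z > z₀, -(1 / 4) ≤ μ / z) (v w : ℝ → ℝ)
    (hv : ContDiffOn ℝ 2 v (Ici z₀))
    (hvo : ∀ z : ℝ, z > z₀ → deriv (deriv v) z + deriv v z - (μ / z) * v z = 0)
    (hvi : IntegrableOn (fun s => v s ^ 2 * Real.exp s) (Ioi z₀))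
    (hw : ContDiffOn ℝ 2 w (Ici z₀))
    (hwo : ∀ z : ℝ, z > z₀ → deriv (deriv w) z + deriv w z - (μ / z) * w z = 0)
    (hwi : IntegrableOn (fun s => w s ^ 2 * Real.exp s) (Ioi z₀)) (h0 : v z₀ = w z₀) :
    EqOn v w (Ici z₀) := by
  -- derivatives of a C² function on `Ici`
  have key : ∀ f : ℝ → ℝ, ContDiffOn ℝ 2 f (Ici z₀) →
      ContinuousOn (derivWithin f (Ici z₀)) (Ici z₀) ∧
      ∀ z > z₀, HasDerivAt f (derivWithin f (Ici z₀) z) z ∧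
        derivWithin f (Ici z₀) z = deriv f z ∧
        HasDerivAt (derivWithin f (Ici z₀)) (deriv (deriv f) z) z := by
    intro f hf
    have hu := uniqueDiffOn_Ici z₀
    have h1 : ContDiffOn ℝ 1 (derivWithin f (Ici z₀)) (Ici z₀) :=
      hf.derivWithin hu (by norm_num)
    refine ⟨h1.continuousOn, fun z hz => ?_⟩
    have hmem : Ici z₀ ∈ nhds z := Ici_mem_nhds hz
    have hd : DifferentiableAt ℝ f z :=
      (hf.differentiableOn (by norm_num) z (mem_Ici.2 hz.le)).differentiableAt hmem
    have e1 : derivWithin f (Ici z₀) z = deriv f z := derivWithin_of_mem_nhds hmem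
    refine ⟨e1 ▸ hd.hasDerivAt, e1, ?_⟩
    have hd1 : DifferentiableAt ℝ (derivWithin f (Ici z₀)) z :=
      (h1.differentiableOn (by norm_num) z (mem_Ici.2 hz.le)).differentiableAt hmem
    have e2 : derivWithin f (Ici z₀) =ᶠ[nhds z] deriv f := by
      filter_upwards [Ioi_mem_nhds hz] with y hy
      exact derivWithin_of_mem_nhds (Ici_mem_nhds hy)
    rw [← e2.deriv_eq]
    exact hd1.hasDerivAt
  obtain ⟨hvc, hvd⟩ := key v hv
  obtain ⟨hwc, hwd⟩ := key w hw
  set v1 := derivWithin v (Ici z₀)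
  set w1 := derivWithin w (Ici z₀)
  have cv := hv.continuousOn
  have cw := hw.continuousOn
  set N : ℝ → ℝ := fun z =>
    Real.exp z * (2 * (v z - w z) * (v1 z - w1 z) + (v z - w z) ^ 2) with hN
  set G : ℝ → ℝ := fun z => (v z - w z) ^ 2 * Real.exp z with hG
  have hNm : MonotoneOn N (Ici z₀) := by
    apply monotoneOn_of_hasDerivWithinAt_nonneg (convex_Ici z₀)
      (f' := fun z => Real.exp z * (2 * (v z - w z) * (v1 z - w1 z) + (v z - w z) ^ 2)
        + Real.exp z * (2 * (v1 z - w1 z) * (v1 z - w1 z)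
          + 2 * (v z - w z) * (deriv (deriv v) z - deriv (deriv w) z)
          + 2 * (v z - w z) * (v1 z - w1 z)))
    · simp only [hN]; fun_prop
    · intro z hz
      rw [interior_Ici] at hz
      obtain ⟨a1, -, a2⟩ := hvd z hz
      obtain ⟨b1, -, b2⟩ := hwd z hz
      have d1 := a1.sub b1
      have d2 := a2.sub b2
      have := (Real.hasDerivAt_exp z).mul (((d1.const_mul 2).mul d2).add (d1.pow 2))
      refine HasDerivAt.hasDerivWithinAt (this.congr_deriv ?_)
      simp
    · intro z hz
      rw [interior_Ici] at hz
      obtain ⟨-, a1, -⟩ := hvd z hz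
      obtain ⟨-, b1, -⟩ := hwd z hz
      have o1 := hvo z hz
      have o2 := hwo z hz
      have hm := hμ z hz
      rw [← a1] at o1
      rw [← b1] at o2
      have e : deriv (deriv v) z - deriv (deriv w) z
          = (μ / z) * (v z - w z) - (v1 z - w1 z) := by linarith
      rw [e, ← mul_add]
      apply mul_nonneg (Real.exp_pos z).le
      nlinarith [sq_nonneg (2 * (v1 z - w1 z) + (v z - w z)),
        mul_nonneg (by linarith : 0 ≤ μ / z + 1 / 4) (sq_nonneg (v z - w z))]
  have hN0 : ∀ z ≥ z₀, 0 ≤ N z := by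
    intro z hz
    have h : N z₀ ≤ N z := hNm self_mem_Ici (mem_Ici.2 hz) hz
    have : N z₀ = 0 := by simp only [hN, h0]; ring
    linarith
  have hGm : MonotoneOn G (Ici z₀) := by
    apply monotoneOn_of_hasDerivWithinAt_nonneg (convex_Ici z₀) (f' := N)
    · simp only [hG]; fun_prop
    · intro z hz
      rw [interior_Ici] at hz
      have d1 := (hvd z hz).1.sub (hwd z hz).1
      refine HasDerivAt.hasDerivWithinAt
        (((d1.pow 2).mul (Real.hasDerivAt_exp z)).congr_deriv ?_)
      simp [hN]; ring
    · intro z hz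
      rw [interior_Ici] at hz
      exact hN0 z hz.le
  have hGi : IntegrableOn G (Ioi z₀) := by
    refine Integrable.mono' ((hvi.const_mul 2).add (hwi.const_mul 2)) ?_ ?_
    · apply ContinuousOn.aestronglyMeasurable _ measurableSet_Ioi
      apply ContinuousOn.mono _ Ioi_subset_Ici_self
      simp only [hG]; fun_prop
    · refine Filter.Eventually.of_forall fun s => ?_
      simp only [hG, Pi.add_apply]
      rw [Real.norm_of_nonneg (by positivity)]
      nlinarith [Real.exp_pos s, mul_nonneg (sq_nonneg (v s + w s)) (Real.exp_pos s).le]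
  intro z hz
  by_contra hne
  have hpos : 0 < G z := by
    have : v z - w z ≠ 0 := sub_ne_zero.2 hne
    simp only [hG]; positivity
  have h1 : IntegrableOn (fun _ : ℝ => G z) (Ioi z) := by
    refine Integrable.mono' (hGi.mono_set (Ioi_subset_Ioi hz))
      aestronglyMeasurable_const ?_
    refine (ae_restrict_iff' measurableSet_Ioi).2 (Filter.Eventually.of_forall fun s hs => ?_)
    rw [Real.norm_of_nonneg hpos.le]
    exact hGm hz (mem_Ici.2 (le_trans hz (le_of_lt hs))) (le_of_lt hs)
  rw [integrableOn_const_iff] at h1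
  simp [hpos.ne'] at h1

/-- for every `Λ > 0` there is `C(Λ) > 1` such that for every `μ ≥ −Λ`
and `z₀ ≥ C(Λ)` there is a unique function `w`, twice continuously differentiable on
`[z₀,∞)`, with `w'' + w' − (μ/z)w = 0` on `(z₀,∞)`, `w(z₀) = 1` and
`∫_{z₀}^∞ w(s)² e^s ds < ∞`; moreover `0 < w(z) ≤ e^{z₀−z}(z/z₀)^{1+max(−μ,0)}` for
all `z ≥ z₀`, and `|w'(z₀)| ≤ 2 + max(μ,0)`. -/
theorem exists_unique_decaying_solution (Λ : ℝ) (hΛ : Λ > 0) :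
    ∃ C : ℝ, C > 1 ∧
      ∀ μ : ℝ, μ ≥ -Λ → ∀ z₀ : ℝ, z₀ ≥ C →
        ∃ w : ℝ → ℝ,
          (ContDiffOn ℝ 2 w (Ici z₀) ∧
            (∀ z : ℝ, z > z₀ →
              deriv (deriv w) z + deriv w z - (μ / z) * w z = 0) ∧
            w z₀ = 1 ∧
            IntegrableOn (fun s => w s ^ 2 * Real.exp s) (Ioi z₀)) ∧
          (∀ z : ℝ, z ≥ z₀ →
            0 < w z ∧ w z ≤ Real.exp (z₀ - z) * (z / z₀) ^ (1 + max (-μ) 0)) ∧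
          |deriv w z₀| ≤ 2 + max μ 0 ∧
          ∀ v : ℝ → ℝ,
            (ContDiffOn ℝ 2 v (Ici z₀) ∧
              (∀ z : ℝ, z > z₀ →
                deriv (deriv v) z + deriv v z - (μ / z) * v z = 0) ∧
              v z₀ = 1 ∧
              IntegrableOn (fun s => v s ^ 2 * Real.exp s) (Ioi z₀)) →
            EqOn v w (Ici z₀) := by
  refine ⟨4 * (1 + Λ) ^ 2, by nlinarith, fun μ hμ z₀ hz => ?_⟩
  set m := max (-μ) 0 with hm
  have hm0 : 0 ≤ m := le_max_right _ _
  have hmΛ : m ≤ Λ := max_le (by linarith) hΛ.le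
  have hM0 : 0 ≤ max μ 0 := le_max_right _ _
  have hMμ : μ ≤ max μ 0 := le_max_left _ _
  have hz1 : 4 * (1 + Λ) ≤ z₀ := by nlinarith
  have hz0 : 0 < z₀ := by linarith
  have hmm : m * (1 + m) ≤ z₀ := by nlinarith
  set M := max μ 0 with hM
  have hpz : ∀ s, 0 < max s z₀ := fun s => lt_max_of_lt_right hz0
  have hμz : ∀ z ≥ z₀, -(1 / 4) ≤ μ / z := by
    intro z hz'
    rw [le_div_iff₀ (by linarith)]; linarith
  have hμz2 : ∀ z ≥ z₀, μ / z ≤ M := by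
    intro z hz'
    rw [div_le_iff₀ (by linarith)]; nlinarith
  have hmz : ∀ z ≥ z₀, (1 + m) / z ≤ 1 / 4 := by
    intro z hz'
    rw [div_le_iff₀ (by linarith)]; linarith
  have hmz2 : ∀ z ≥ z₀, 0 ≤ (1 + m) / z := fun z hz' => div_nonneg (by linarith) (by linarith)
  obtain ⟨p, p', hp'c, hpd, hp⟩ := riccati (3 / 2 + M) z₀ (by linarith)
    (fun s => 1 / 4 + μ / max s z₀) (fun s => 1 / 2 - (1 + m) / max s z₀)
    (by
      have := fun s => (hpz s).ne'
      fun_prop (disch := exact this))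
    (by
      have := fun s => (hpz s).ne'
      fun_prop (disch := exact this))
    (fun s => by linarith [hμz (max s z₀) (le_max_right _ _)])
    (fun s => by nlinarith [hμz2 (max s z₀) (le_max_right _ _)])
    (fun s => by linarith [hmz (max s z₀) (le_max_right _ _)])
    (fun s => by linarith [hmz2 (max s z₀) (le_max_right _ _)])
    (fun z => (1 + m) / z ^ 2)
    (by
      intro z hz'
      have hzp : 0 < z := by linarith
      have h1 : HasDerivAt (fun s : ℝ => 1 / 2 - (1 + m) / s) ((1 + m) / z ^ 2) z := by
        have := ((hasDerivAt_inv hzp.ne').const_mul (1 + m)).const_sub (1 / 2)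
        refine this.congr_deriv ?_
        field_simp
      refine h1.congr_of_eventuallyEq ?_
      filter_upwards [Ioi_mem_nhds hz'] with y hy
      rw [max_eq_left (le_of_lt hy)])
    (by
      intro z hz'
      have hzp : 0 < z := by linarith
      simp only [max_eq_left hz'.le]
      have h2 : m * (1 + m) ≤ (1 + m + μ) * z := by
        rcases le_total μ 0 with h | h
        · have : m = -μ := max_eq_left (by linarith)
          rw [show 1 + m + μ = 1 by linarith]; linarith
        · have : m = 0 := max_eq_right (by linarith)
          rw [this]; nlinarith
      have h3 : (1 + m) / z ^ 2 - ((1 / 2 - (1 + m) / z) ^ 2 - (1 / 4 + μ / z))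
          = ((1 + m + μ) * z - m * (1 + m)) / z ^ 2 := by
        field_simp; ring
      have : 0 ≤ ((1 + m + μ) * z - m * (1 + m)) / z ^ 2 :=
        div_nonneg (by linarith) (by positivity)
      linarith)
  have hpc : Continuous p := continuous_iff_continuousAt.2 fun z => (hpd z).continuousAt
  have hplow : ∀ z ≥ z₀, 1 / 2 - (1 + m) / z ≤ p z := by
    intro z hz'
    have := (hp z hz').1
    simpa only [max_eq_left hz'] using this
  have hpr : ∀ z ≥ z₀, p' z = p z ^ 2 - (1 / 4 + μ / z) := by
    intro z hz'
    have := (hp z hz').2.2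
    simpa only [max_eq_left hz'] using this
  set w : ℝ → ℝ := fun z => Real.exp (∫ s in z₀..z, -(p s + 1 / 2)) with hw
  have hwpos : ∀ z, 0 < w z := fun z => Real.exp_pos _
  have hwd : ∀ z, HasDerivAt w (w z * -(p z + 1 / 2)) z := by
    intro z
    have hcc : Continuous fun s => -(p s + 1 / 2) := by fun_prop
    exact (hcc.integral_hasStrictDerivAt z₀ z).hasDerivAt.exp
  have hwc : Continuous w := continuous_iff_continuousAt.2 fun z => (hwd z).continuousAt
  have hw1 : deriv w = fun z => w z * -(p z + 1 / 2) := funext fun z => (hwd z).deriv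
  have hwd2 : ∀ z, HasDerivAt (deriv w)
      (w z * -(p z + 1 / 2) * -(p z + 1 / 2) + w z * -(p' z)) z := by
    intro z
    rw [hw1]
    exact (hwd z).mul ((hpd z).add_const (1 / 2)).neg
  have hw2 : deriv (deriv w) =
      fun z => w z * -(p z + 1 / 2) * -(p z + 1 / 2) + w z * -(p' z) :=
    funext fun z => (hwd2 z).deriv
  have hC2 : ContDiff ℝ 2 w := by
    have h1 : ContDiff ℝ 1 (deriv w) := by
      rw [contDiff_one_iff_deriv]
      refine ⟨fun z => (hwd2 z).differentiableAt, ?_⟩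
      rw [hw2]; fun_prop
    rw [show (2 : WithTop ℕ∞) = 1 + 1 by norm_num, contDiff_succ_iff_deriv]
    exact ⟨fun z => (hwd z).differentiableAt, by simp, h1⟩
  have hwz : w z₀ = 1 := by simp [hw]
  have hode : ∀ z : ℝ, z > z₀ → deriv (deriv w) z + deriv w z - (μ / z) * w z = 0 := by
    intro z hz'
    rw [hw2, hw1]
    simp only [hpr z hz'.le]
    ring
  have hint : IntegrableOn (fun s => w s ^ 2 * Real.exp s) (Ioi z₀) := by
    have hanti : AntitoneOn (fun s => w s ^ 2 * Real.exp (3 / 2 * s)) (Ici z₀) := by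
      apply antitoneOn_of_hasDerivWithinAt_nonpos (convex_Ici z₀)
        (f' := fun s => (2 * w s * (w s * -(p s + 1 / 2))) * Real.exp (3 / 2 * s)
          + w s ^ 2 * (Real.exp (3 / 2 * s) * (3 / 2)))
      · exact Continuous.continuousOn (by fun_prop)
      · intro x hx
        have he : HasDerivAt (fun s : ℝ => Real.exp (3 / 2 * s))
            (Real.exp (3 / 2 * x) * (3 / 2)) x := by
          simpa using ((hasDerivAt_id x).const_mul (3 / 2 : ℝ)).exp
        refine HasDerivAt.hasDerivWithinAt ((((hwd x).pow 2).mul he).congr_deriv ?_)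
        simp
      · intro x hx
        rw [interior_Ici] at hx
        have h1 := hplow x (le_of_lt hx)
        have h2 := hmz x (le_of_lt hx)
        have h3 : 0 ≤ w x ^ 2 * Real.exp (3 / 2 * x) := by positivity
        nlinarith [mul_nonneg h3 (by linarith : 0 ≤ p x - 1 / 4)]
    have hi : IntegrableOn (fun s => Real.exp (-(1 / 2) * s)
        * (w z₀ ^ 2 * Real.exp (3 / 2 * z₀))) (Ioi z₀) :=
      (integrableOn_exp_mul_Ioi (by norm_num) z₀).mul_const _
    refine Integrable.mono' hi (Continuous.aestronglyMeasurable (by fun_prop)) ?_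
    refine (ae_restrict_iff' measurableSet_Ioi).2 (Filter.Eventually.of_forall fun s hs => ?_)
    rw [Real.norm_of_nonneg (by positivity)]
    have h1 := hanti self_mem_Ici (mem_Ici.2 (le_of_lt hs)) (le_of_lt hs)
    have h2 : w s ^ 2 * Real.exp s
        = Real.exp (-(1 / 2) * s) * (w s ^ 2 * Real.exp (3 / 2 * s)) := by
      rw [mul_left_comm, ← Real.exp_add]; ring_nf
    rw [h2]
    exact mul_le_mul_of_nonneg_left h1 (Real.exp_pos _).le
  refine ⟨w, ⟨hC2.contDiffOn, hode, hwz, hint⟩, fun z hz' => ⟨hwpos z, ?_⟩, ?_, ?_⟩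
  · have hlog : MonotoneOn (fun y => (∫ s in z₀..y, (p s + 1 / 2))
        + (z₀ - y) + (1 + m) * Real.log (y / z₀)) (Ici z₀) := by
      apply monotoneOn_of_hasDerivWithinAt_nonneg (convex_Ici z₀)
        (f' := fun y => (p y + 1 / 2) + (-1) + (1 + m) * ((1 / z₀) / (y / z₀)))
      · apply ContinuousOn.add
        · apply Continuous.continuousOn
          have hcc : Continuous fun s => (p s + 1 / 2) := by fun_prop
          have : Continuous fun y => ∫ s in z₀..y, (p s + 1 / 2) :=
            continuous_iff_continuousAt.2 fun y =>
              (hcc.integral_hasStrictDerivAt z₀ y).hasDerivAt.continuousAt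
          fun_prop
        · apply ContinuousOn.mul continuousOn_const
          apply ContinuousOn.log (by fun_prop)
          intro x hx
          have : 0 < x := lt_of_lt_of_le hz0 hx
          positivity
      · intro x hx
        rw [interior_Ici] at hx
        have hxp : 0 < x := lt_trans hz0 hx
        have hcc : Continuous fun s => (p s + 1 / 2) := by fun_prop
        apply HasDerivAt.hasDerivWithinAt
        exact ((hcc.integral_hasStrictDerivAt z₀ x).hasDerivAt.add
          ((hasDerivAt_id x).const_sub z₀)).add
          ((((hasDerivAt_id x).div_const z₀).log (by simp; constructor <;> positivity)).const_mul
            (1 + m))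
      · intro x hx
        rw [interior_Ici] at hx
        have hxp : 0 < x := lt_trans hz0 hx
        have h1 := hplow x (le_of_lt hx)
        have : (1 + m) * ((1 / z₀) / (x / z₀)) = (1 + m) / x := by field_simp
        rw [this]; linarith
    have h1 := hlog self_mem_Ici (mem_Ici.2 hz') hz'
    simp [hz0.ne'] at h1
    have hzz : 0 < z / z₀ := div_pos (by linarith) hz0
    rw [Real.rpow_def_of_pos hzz, ← Real.exp_add]
    simp only [hw]
    apply Real.exp_le_exp.2
    rw [intervalIntegral.integral_neg]
    norm_num
    linarith
  · rw [hw1]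
    simp only [hwz]
    have h1 := hplow z₀ le_rfl
    have h2 := hmz z₀ le_rfl
    have h3 := (hp z₀ le_rfl).2.1
    rw [abs_le]; constructor <;> linarith
  · rintro v ⟨hv, hvo, hv0, hvi⟩
    exact uniq μ z₀ hz0 (fun z hz' => hμz z hz'.le) v w hv hvo hvi hC2.contDiffOn hode hint
      (by rw [hv0, hwz])
end

section
/- Let Λ ≥ 1, let μ ∈ ℝ with −Λ ≤ μ ≤ 0, and let z₀ ≥ 100·(1+Λ²). Define a₊(z) := e^{−z+z₀}·(z/z₀)^{−μ+1} and a₋(z) := e^{−z+z₀}·(z/z₀)^{−μ−1}. Then for every z ≥ z₀ one has (𝓛_μ a₊)(z) ≤ 0 and (𝓛_μ a₋)(z) ≥ 0. -/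
open Set

lemma barrier_deriv_one (p z₀ w : ℝ) (h0 : 0 < z₀) (hw : 0 < w) :
    HasDerivAt (fun w : ℝ => Real.exp (-w + z₀) * (w / z₀) ^ p)
      ((Real.exp (-w + z₀) * (w / z₀) ^ p) * (-1 + p / w)) w := by
  have hq : 0 < w / z₀ := div_pos hw h0
  have h1 : HasDerivAt (fun w : ℝ => Real.exp (-w + z₀)) (Real.exp (-w + z₀) * (-1)) w :=
    ((hasDerivAt_id w).neg.add_const z₀).exp
  have h2 : HasDerivAt (fun w : ℝ => (w / z₀) ^ p) (1 / z₀ * p * (w / z₀) ^ (p - 1)) w :=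
    ((hasDerivAt_id w).div_const z₀).rpow_const (Or.inl hq.ne')
  refine (h1.mul h2).congr_deriv ?_
  rw [Real.rpow_sub_one hq.ne']
  field_simp

lemma barrier_operator (p μ z₀ z : ℝ) (h0 : 0 < z₀) (hz : 0 < z) :
    deriv (deriv (fun w : ℝ => Real.exp (-w + z₀) * (w / z₀) ^ p)) z
        + deriv (fun w : ℝ => Real.exp (-w + z₀) * (w / z₀) ^ p) z
        - (μ / z) * (Real.exp (-z + z₀) * (z / z₀) ^ p)
      = (Real.exp (-z + z₀) * (z / z₀) ^ p) / z ^ 2 * ((-p - μ) * z + p * (p - 1)) := by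
  have he : deriv (fun w : ℝ => Real.exp (-w + z₀) * (w / z₀) ^ p) =ᶠ[nhds z]
      fun w => (Real.exp (-w + z₀) * (w / z₀) ^ p) * (-1 + p / w) := by
    filter_upwards [lt_mem_nhds hz] with w hw
    exact (barrier_deriv_one p z₀ w h0 hw).deriv
  have h1 := barrier_deriv_one p z₀ z h0 hz
  have h3 : HasDerivAt (fun w : ℝ => -1 + p / w) (p * (-(z ^ 2)⁻¹)) z := by
    simpa [div_eq_mul_inv] using ((hasDerivAt_inv hz.ne').const_mul p).const_add (-1)
  have h2 := (h1.mul h3).deriv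
  rw [he.deriv_eq, h1.deriv]
  erw [h2]
  generalize Real.exp (-z + z₀) * (z / z₀) ^ p = u
  field_simp
  ring

/-- for `1 ≤ Λ`, `−Λ ≤ μ ≤ 0` and `z₀ ≥ 100(1+Λ²)`, the functions
`a₊(z) = e^{−z+z₀}(z/z₀)^{−μ+1}` and `a₋(z) = e^{−z+z₀}(z/z₀)^{−μ−1}` satisfy
`𝓛_μ a₊ ≤ 0 ≤ 𝓛_μ a₋` on `[z₀,∞)`, where `𝓛_μ u = u'' + u' − (μ/z)u`. -/
theorem barriers_for_decaying_solution (Λ μ z₀ : ℝ) (hΛ : 1 ≤ Λ)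
    (hμl : -Λ ≤ μ) (hμu : μ ≤ 0) (hz₀ : z₀ ≥ 100 * (1 + Λ ^ 2))
    (z : ℝ) (hz : z ≥ z₀) :
    (deriv (deriv (fun w : ℝ => Real.exp (-w + z₀) * (w / z₀) ^ (-μ + 1))) z
        + deriv (fun w : ℝ => Real.exp (-w + z₀) * (w / z₀) ^ (-μ + 1)) z
        - (μ / z) * (Real.exp (-z + z₀) * (z / z₀) ^ (-μ + 1)) ≤ 0) ∧
    (0 ≤ deriv (deriv (fun w : ℝ => Real.exp (-w + z₀) * (w / z₀) ^ (-μ - 1))) z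
        + deriv (fun w : ℝ => Real.exp (-w + z₀) * (w / z₀) ^ (-μ - 1)) z
        - (μ / z) * (Real.exp (-z + z₀) * (z / z₀) ^ (-μ - 1))) := by
  have h0 : 0 < z₀ := by nlinarith
  have hzp : 0 < z := by linarith
  have hsq : μ ^ 2 ≤ Λ ^ 2 := by nlinarith
  have hu : ∀ p : ℝ, 0 ≤ (Real.exp (-z + z₀) * (z / z₀) ^ p) / z ^ 2 := fun p => by positivity
  rw [barrier_operator _ μ z₀ z h0 hzp, barrier_operator _ μ z₀ z h0 hzp]
  constructor
  · exact mul_nonpos_of_nonneg_of_nonpos (hu _) (by nlinarith)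
  · exact mul_nonneg (hu _) (by nlinarith)
end
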